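/- Bisimulation equivalence ↔ is a congruence with respect to all the operators of ACPrec: if t₁ ↔ t₁' and t₂ ↔ t₂' for closed ACPrec terms, then t₁ + t₂ ↔ t₁' + t₂', t₁ · t₂ ↔ t₁' · t₂', t₁ ∥ t₂ ↔ t₁' ∥ t₂', t₁ ⌊⌊ t₂ ↔ t₁' ⌊⌊ t₂', t₁ | t₂ ↔ t₁' | t₂', and ∂_H(t₁) ↔ ∂_H(t₁') for all H ⊆ Act. -/

import Mathlib

namespace ACPNote

/-! ### ACP terms

We fix a set `Act` of actions.  The inaction constant δ is not in `Act`; the set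
`Act ∪ {δ}` of constants is represented by `Option Act`, with `none` playing the
role of δ.  The countably infinite set of variables is represented by `ℕ`. -/

/-- Terms over the signature of ACP, with action constants from `Act`,
the inaction constant δ, variables from `ℕ`, alternative composition `alt`,
sequential composition `seq`, parallel composition `par`, left merge `lm`,
communication merge `cm`, and encapsulation operators `encap H` for `H ⊆ Act`. -/
inductive ACPTerm (Act : Type) : Type
  | act : Act → ACPTerm Act
  | delta : ACPTerm Act
  | var : ℕ → ACPTerm Act
  | alt : ACPTerm Act → ACPTerm Act → ACPTerm Act
  | seq : ACPTerm Act → ACPTerm Act → ACPTerm Act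
  | par : ACPTerm Act → ACPTerm Act → ACPTerm Act
  | lm : ACPTerm Act → ACPTerm Act → ACPTerm Act
  | cm : ACPTerm Act → ACPTerm Act → ACPTerm Act
  | encap : Set Act → ACPTerm Act → ACPTerm Act

/-- The ACP constant corresponding to an element of `Act ∪ {δ}`
(`none` is δ, `some a` is the action constant `a`). -/
def ACPTerm.ofConst {Act : Type} : Option Act → ACPTerm Act
  | none => .delta
  | some a => .act a

/-- Derivability of equations between ACP terms from the axioms of ACP
(A1–A7, CM1–CM9, CF, D1–D4) in equational logic: the axioms are stated as
schemas (i.e. closed under substitution) and derivability is closed under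
reflexivity, symmetry, transitivity and congruence for all operators.
The communication function `γ` on `Act ∪ {δ}` interprets the communication
merge on constants (axiom CF). -/
inductive ACPDeriv {Act : Type} (γ : Option Act → Option Act → Option Act) :
    ACPTerm Act → ACPTerm Act → Prop
  | refl (t) : ACPDeriv γ t t
  | symm {t s} : ACPDeriv γ t s → ACPDeriv γ s t
  | trans {t s u} : ACPDeriv γ t s → ACPDeriv γ s u → ACPDeriv γ t u
  | altCongr {t t' s s'} : ACPDeriv γ t t' → ACPDeriv γ s s' →
      ACPDeriv γ (.alt t s) (.alt t' s')
  | seqCongr {t t' s s'} : ACPDeriv γ t t' → ACPDeriv γ s s' →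
      ACPDeriv γ (.seq t s) (.seq t' s')
  | parCongr {t t' s s'} : ACPDeriv γ t t' → ACPDeriv γ s s' →
      ACPDeriv γ (.par t s) (.par t' s')
  | lmCongr {t t' s s'} : ACPDeriv γ t t' → ACPDeriv γ s s' →
      ACPDeriv γ (.lm t s) (.lm t' s')
  | cmCongr {t t' s s'} : ACPDeriv γ t t' → ACPDeriv γ s s' →
      ACPDeriv γ (.cm t s) (.cm t' s')
  | encapCongr (H : Set Act) {t t'} : ACPDeriv γ t t' →
      ACPDeriv γ (.encap H t) (.encap H t')
  | A1 (x y) : ACPDeriv γ (.alt x y) (.alt y x)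
  | A2 (x y z) : ACPDeriv γ (.alt (.alt x y) z) (.alt x (.alt y z))
  | A3 (x) : ACPDeriv γ (.alt x x) x
  | A4 (x y z) : ACPDeriv γ (.seq (.alt x y) z) (.alt (.seq x z) (.seq y z))
  | A5 (x y z) : ACPDeriv γ (.seq (.seq x y) z) (.seq x (.seq y z))
  | A6 (x) : ACPDeriv γ (.alt x .delta) x
  | A7 (x) : ACPDeriv γ (.seq .delta x) .delta
  | CM1 (x y) : ACPDeriv γ (.par x y) (.alt (.alt (.lm x y) (.lm y x)) (.cm x y))
  | CM2 (a : Option Act) (x) :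
      ACPDeriv γ (.lm (.ofConst a) x) (.seq (.ofConst a) x)
  | CM3 (a : Option Act) (x y) :
      ACPDeriv γ (.lm (.seq (.ofConst a) x) y) (.seq (.ofConst a) (.par x y))
  | CM4 (x y z) : ACPDeriv γ (.lm (.alt x y) z) (.alt (.lm x z) (.lm y z))
  | CM5 (a b : Option Act) (x) :
      ACPDeriv γ (.cm (.seq (.ofConst a) x) (.ofConst b))
        (.seq (.cm (.ofConst a) (.ofConst b)) x)
  | CM6 (a b : Option Act) (x) :
      ACPDeriv γ (.cm (.ofConst a) (.seq (.ofConst b) x))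
        (.seq (.cm (.ofConst a) (.ofConst b)) x)
  | CM7 (a b : Option Act) (x y) :
      ACPDeriv γ (.cm (.seq (.ofConst a) x) (.seq (.ofConst b) y))
        (.seq (.cm (.ofConst a) (.ofConst b)) (.par x y))
  | CM8 (x y z) : ACPDeriv γ (.cm (.alt x y) z) (.alt (.cm x z) (.cm y z))
  | CM9 (x y z) : ACPDeriv γ (.cm x (.alt y z)) (.alt (.cm x y) (.cm x z))
  | CF (a b : Option Act) :
      ACPDeriv γ (.cm (.ofConst a) (.ofConst b)) (.ofConst (γ a b))
  | D1 (a : Option Act) (H : Set Act) (h : ∀ b, a = some b → b ∉ H) :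
      ACPDeriv γ (.encap H (.ofConst a)) (.ofConst a)
  | D2 (a : Act) (H : Set Act) (h : a ∈ H) :
      ACPDeriv γ (.encap H (.act a)) .delta
  | D3 (H : Set Act) (x y) :
      ACPDeriv γ (.encap H (.alt x y)) (.alt (.encap H x) (.encap H y))
  | D4 (H : Set Act) (x y) :
      ACPDeriv γ (.encap H (.seq x y)) (.seq (.encap H x) (.encap H y))

/-- A term is guarded when every occurrence of a variable in it occurs within a
subterm of the form `a · t'` with `a ∈ Act`. -/
def ACPTerm.Guarded {Act : Type} : ACPTerm Act → Prop
  | .act _ => True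
  | .delta => True
  | .var _ => False
  | .alt t s => t.Guarded ∧ s.Guarded
  | .seq t s => (∃ a : Act, t = .act a) ∨ (t.Guarded ∧ s.Guarded)
  | .par t s => t.Guarded ∧ s.Guarded
  | .lm t s => t.Guarded ∧ s.Guarded
  | .cm t s => t.Guarded ∧ s.Guarded
  | .encap _ t => t.Guarded

/-- Head normal forms of ACP: δ, action constants `a`, terms `a · t`
with `a ∈ Act`, and alternative compositions of head normal forms. -/
inductive ACPTerm.HNF {Act : Type} : ACPTerm Act → Prop
  | delta : HNF .delta
  | act (a : Act) : HNF (.act a)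
  | seqAct (a : Act) (t : ACPTerm Act) : HNF (.seq (.act a) t)
  | alt {t t'} : HNF t → HNF t' → HNF (.alt t t')

/-- Linear ACP terms: δ, action constants `a`, terms `a · X` with `a ∈ Act`
and `X` a variable, and alternative compositions of linear terms. -/
inductive ACPTerm.Linear {Act : Type} : ACPTerm Act → Prop
  | delta : Linear .delta
  | act (a : Act) : Linear (.act a)
  | seqVar (a : Act) (X : ℕ) : Linear (.seq (.act a) (.var X))
  | alt {t t'} : Linear t → Linear t' → Linear (.alt t t')

/-- The generalized sum `Σ_{i<n} tᵢ`: the empty sum is δ, a sum of one summand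
is that summand, and `Σ_{i<n+1} tᵢ = (Σ_{i<n} tᵢ) + tₙ`. -/
def bigAlt {Act : Type} : (n : ℕ) → (Fin n → ACPTerm Act) → ACPTerm Act
  | 0, _ => .delta
  | 1, f => f 0
  | n + 2, f => .alt (bigAlt (n + 1) fun i => f i.castSucc) (f (Fin.last (n + 1)))

/-- The set of variables occurring in an ACP term. -/
def ACPTerm.varsOf {Act : Type} : ACPTerm Act → Set ℕ
  | .act _ => ∅
  | .delta => ∅
  | .var X => {X}
  | .alt t s => t.varsOf ∪ s.varsOf
  | .seq t s => t.varsOf ∪ s.varsOf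
  | .par t s => t.varsOf ∪ s.varsOf
  | .lm t s => t.varsOf ∪ s.varsOf
  | .cm t s => t.varsOf ∪ s.varsOf
  | .encap _ t => t.varsOf

/-! ### Guarded recursive specifications and ACPrec -/

/-- Rewriting of ACP terms using the axioms of ACP in either direction and/or
the equations `X_j = t_j` (for `j ∈ dom`, `j ≠ i`) of a recursive specification
from left to right; it is reflexive, transitive and compatible with all
operators, but the specification equations may only be used left-to-right. -/
inductive Rewrites {Act : Type} (γ : Option Act → Option Act → Option Act)
    (rhs : ℕ → ACPTerm Act) (dom : Set ℕ) (i : ℕ) :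
    ACPTerm Act → ACPTerm Act → Prop
  | acp {t s} : ACPDeriv γ t s → Rewrites γ rhs dom i t s
  | unfold {j} (h : j ∈ dom) (hne : j ≠ i) : Rewrites γ rhs dom i (.var j) (rhs j)
  | trans {t s u} : Rewrites γ rhs dom i t s → Rewrites γ rhs dom i s u →
      Rewrites γ rhs dom i t u
  | altCongr {t t' s s'} : Rewrites γ rhs dom i t t' → Rewrites γ rhs dom i s s' →
      Rewrites γ rhs dom i (.alt t s) (.alt t' s')
  | seqCongr {t t' s s'} : Rewrites γ rhs dom i t t' → Rewrites γ rhs dom i s s' →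
      Rewrites γ rhs dom i (.seq t s) (.seq t' s')
  | parCongr {t t' s s'} : Rewrites γ rhs dom i t t' → Rewrites γ rhs dom i s s' →
      Rewrites γ rhs dom i (.par t s) (.par t' s')
  | lmCongr {t t' s s'} : Rewrites γ rhs dom i t t' → Rewrites γ rhs dom i s s' →
      Rewrites γ rhs dom i (.lm t s) (.lm t' s')
  | cmCongr {t t' s s'} : Rewrites γ rhs dom i t t' → Rewrites γ rhs dom i s s' →
      Rewrites γ rhs dom i (.cm t s) (.cm t' s')
  | encapCongr (H : Set Act) {t t'} : Rewrites γ rhs dom i t t' →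
      Rewrites γ rhs dom i (.encap H t) (.encap H t')

/-- A guarded recursive specification over ACP: a set of recursion equations
`X = rhs X` for `X ∈ dom` (with pairwise distinct left-hand side variables,
which our functional representation enforces), such that each right-hand side
is a guarded ACP term in which only variables from `dom` occur, or is
rewritable to such a term using the ACP axioms in either direction and/or the
other equations of the specification from left to right. -/
structure GRS (Act : Type) (γ : Option Act → Option Act → Option Act) : Type where
  dom : Set ℕ
  rhs : ℕ → ACPTerm Act
  guarded : ∀ i ∈ dom, ∃ t', Rewrites γ rhs dom i (rhs i) t' ∧
      t'.Guarded ∧ t'.varsOf ⊆ dom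

/-- A linear recursive specification: a guarded recursive specification whose
right-hand sides are all linear ACP terms. -/
def GRS.Linear {Act : Type} {γ : Option Act → Option Act → Option Act}
    (E : GRS Act γ) : Prop :=
  ∀ i ∈ E.dom, (E.rhs i).Linear

/-- Terms over the signature of ACPrec: the signature of ACP extended with a
constant `rec X E` (written ⟨X|E⟩) for each guarded recursive specification
`E` over ACP and each variable `X` of `E`. -/
inductive ACPrTerm (Act : Type) (γ : Option Act → Option Act → Option Act) : Type
  | act : Act → ACPrTerm Act γ
  | delta : ACPrTerm Act γ
  | var : ℕ → ACPrTerm Act γ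
  | recur : ℕ → GRS Act γ → ACPrTerm Act γ
  | alt : ACPrTerm Act γ → ACPrTerm Act γ → ACPrTerm Act γ
  | seq : ACPrTerm Act γ → ACPrTerm Act γ → ACPrTerm Act γ
  | par : ACPrTerm Act γ → ACPrTerm Act γ → ACPrTerm Act γ
  | lm : ACPrTerm Act γ → ACPrTerm Act γ → ACPrTerm Act γ
  | cm : ACPrTerm Act γ → ACPrTerm Act γ → ACPrTerm Act γ
  | encap : Set Act → ACPrTerm Act γ → ACPrTerm Act γ

/-- The ACPrec constant corresponding to an element of `Act ∪ {δ}`. -/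
def ACPrTerm.ofConst {Act : Type} {γ : Option Act → Option Act → Option Act} :
    Option Act → ACPrTerm Act γ
  | none => .delta
  | some a => .act a

/-- The embedding of ACP terms into ACPrec terms. -/
def ACPTerm.toACPr {Act : Type} (γ : Option Act → Option Act → Option Act) :
    ACPTerm Act → ACPrTerm Act γ
  | .act a => .act a
  | .delta => .delta
  | .var X => .var X
  | .alt t s => .alt (t.toACPr γ) (s.toACPr γ)
  | .seq t s => .seq (t.toACPr γ) (s.toACPr γ)
  | .par t s => .par (t.toACPr γ) (s.toACPr γ)
  | .lm t s => .lm (t.toACPr γ) (s.toACPr γ)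
  | .cm t s => .cm (t.toACPr γ) (s.toACPr γ)
  | .encap H t => .encap H (t.toACPr γ)

open Classical in
/-- `⟨t|E⟩`: the ACPrec term obtained from the ACP term `t` by replacing every
occurrence of a variable `X` of `E` by the constant `⟨X|E⟩`. -/
noncomputable def GRS.sub {Act : Type} {γ : Option Act → Option Act → Option Act}
    (E : GRS Act γ) : ACPTerm Act → ACPrTerm Act γ
  | .act a => .act a
  | .delta => .delta
  | .var X => if X ∈ E.dom then .recur X E else .var X
  | .alt t s => .alt (E.sub t) (E.sub s)
  | .seq t s => .seq (E.sub t) (E.sub s)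
  | .par t s => .par (E.sub t) (E.sub s)
  | .lm t s => .lm (E.sub t) (E.sub s)
  | .cm t s => .cm (E.sub t) (E.sub s)
  | .encap H t => .encap H (E.sub t)

/-- Substitution of ACPrec terms for variables in an ACPrec term. -/
def ACPrTerm.subst {Act : Type} {γ : Option Act → Option Act → Option Act}
    (σ : ℕ → ACPrTerm Act γ) : ACPrTerm Act γ → ACPrTerm Act γ
  | .act a => .act a
  | .delta => .delta
  | .var X => σ X
  | .recur X E => .recur X E
  | .alt t s => .alt (t.subst σ) (s.subst σ)
  | .seq t s => .seq (t.subst σ) (s.subst σ)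
  | .par t s => .par (t.subst σ) (s.subst σ)
  | .lm t s => .lm (t.subst σ) (s.subst σ)
  | .cm t s => .cm (t.subst σ) (s.subst σ)
  | .encap H t => .encap H (t.subst σ)

/-- Guardedness for ACPrec terms: every occurrence of a variable occurs within
a subterm of the form `a · t'` with `a ∈ Act`. -/
def ACPrTerm.Guarded {Act : Type} {γ : Option Act → Option Act → Option Act} :
    ACPrTerm Act γ → Prop
  | .act _ => True
  | .delta => True
  | .var _ => False
  | .recur _ _ => True
  | .alt t s => t.Guarded ∧ s.Guarded
  | .seq t s => (∃ a : Act, t = .act a) ∨ (t.Guarded ∧ s.Guarded)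
  | .par t s => t.Guarded ∧ s.Guarded
  | .lm t s => t.Guarded ∧ s.Guarded
  | .cm t s => t.Guarded ∧ s.Guarded
  | .encap _ t => t.Guarded

/-- Closed ACPrec terms: terms in which no variable occurs. -/
def ACPrTerm.Closed {Act : Type} {γ : Option Act → Option Act → Option Act} :
    ACPrTerm Act γ → Prop
  | .act _ => True
  | .delta => True
  | .var _ => False
  | .recur _ _ => True
  | .alt t s => t.Closed ∧ s.Closed
  | .seq t s => t.Closed ∧ s.Closed
  | .par t s => t.Closed ∧ s.Closed
  | .lm t s => t.Closed ∧ s.Closed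
  | .cm t s => t.Closed ∧ s.Closed
  | .encap _ t => t.Closed

/-- Head normal forms of ACPrec. -/
inductive ACPrTerm.HNF {Act : Type} {γ : Option Act → Option Act → Option Act} :
    ACPrTerm Act γ → Prop
  | delta : HNF .delta
  | act (a : Act) : HNF (.act a)
  | seqAct (a : Act) (t : ACPrTerm Act γ) : HNF (.seq (.act a) t)
  | alt {t t'} : HNF t → HNF t' → HNF (.alt t t')

/-- Derivability of equations between ACPrec terms from the axioms of ACPrec
(the axioms of ACP together with RDP and RSP) in infinitary conditional
equational logic: the axioms are stated as schemas, derivability is closed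
under reflexivity, symmetry, transitivity and congruence, and the rule RSP may
have infinitely many premises (one for each equation of the specification),
instantiated by an arbitrary substitution `σ`. -/
inductive ACPrDeriv {Act : Type} (γ : Option Act → Option Act → Option Act) :
    ACPrTerm Act γ → ACPrTerm Act γ → Prop
  | refl (t) : ACPrDeriv γ t t
  | symm {t s} : ACPrDeriv γ t s → ACPrDeriv γ s t
  | trans {t s u} : ACPrDeriv γ t s → ACPrDeriv γ s u → ACPrDeriv γ t u
  | altCongr {t t' s s'} : ACPrDeriv γ t t' → ACPrDeriv γ s s' →
      ACPrDeriv γ (.alt t s) (.alt t' s')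
  | seqCongr {t t' s s'} : ACPrDeriv γ t t' → ACPrDeriv γ s s' →
      ACPrDeriv γ (.seq t s) (.seq t' s')
  | parCongr {t t' s s'} : ACPrDeriv γ t t' → ACPrDeriv γ s s' →
      ACPrDeriv γ (.par t s) (.par t' s')
  | lmCongr {t t' s s'} : ACPrDeriv γ t t' → ACPrDeriv γ s s' →
      ACPrDeriv γ (.lm t s) (.lm t' s')
  | cmCongr {t t' s s'} : ACPrDeriv γ t t' → ACPrDeriv γ s s' →
      ACPrDeriv γ (.cm t s) (.cm t' s')
  | encapCongr (H : Set Act) {t t'} : ACPrDeriv γ t t' →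
      ACPrDeriv γ (.encap H t) (.encap H t')
  | A1 (x y) : ACPrDeriv γ (.alt x y) (.alt y x)
  | A2 (x y z) : ACPrDeriv γ (.alt (.alt x y) z) (.alt x (.alt y z))
  | A3 (x) : ACPrDeriv γ (.alt x x) x
  | A4 (x y z) : ACPrDeriv γ (.seq (.alt x y) z) (.alt (.seq x z) (.seq y z))
  | A5 (x y z) : ACPrDeriv γ (.seq (.seq x y) z) (.seq x (.seq y z))
  | A6 (x) : ACPrDeriv γ (.alt x .delta) x
  | A7 (x) : ACPrDeriv γ (.seq .delta x) .delta
  | CM1 (x y) : ACPrDeriv γ (.par x y) (.alt (.alt (.lm x y) (.lm y x)) (.cm x y))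
  | CM2 (a : Option Act) (x) :
      ACPrDeriv γ (.lm (.ofConst a) x) (.seq (.ofConst a) x)
  | CM3 (a : Option Act) (x y) :
      ACPrDeriv γ (.lm (.seq (.ofConst a) x) y) (.seq (.ofConst a) (.par x y))
  | CM4 (x y z) : ACPrDeriv γ (.lm (.alt x y) z) (.alt (.lm x z) (.lm y z))
  | CM5 (a b : Option Act) (x) :
      ACPrDeriv γ (.cm (.seq (.ofConst a) x) (.ofConst b))
        (.seq (.cm (.ofConst a) (.ofConst b)) x)
  | CM6 (a b : Option Act) (x) :
      ACPrDeriv γ (.cm (.ofConst a) (.seq (.ofConst b) x))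
        (.seq (.cm (.ofConst a) (.ofConst b)) x)
  | CM7 (a b : Option Act) (x y) :
      ACPrDeriv γ (.cm (.seq (.ofConst a) x) (.seq (.ofConst b) y))
        (.seq (.cm (.ofConst a) (.ofConst b)) (.par x y))
  | CM8 (x y z) : ACPrDeriv γ (.cm (.alt x y) z) (.alt (.cm x z) (.cm y z))
  | CM9 (x y z) : ACPrDeriv γ (.cm x (.alt y z)) (.alt (.cm x y) (.cm x z))
  | CF (a b : Option Act) :
      ACPrDeriv γ (.cm (.ofConst a) (.ofConst b)) (.ofConst (γ a b))
  | D1 (a : Option Act) (H : Set Act) (h : ∀ b, a = some b → b ∉ H) :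
      ACPrDeriv γ (.encap H (.ofConst a)) (.ofConst a)
  | D2 (a : Act) (H : Set Act) (h : a ∈ H) :
      ACPrDeriv γ (.encap H (.act a)) .delta
  | D3 (H : Set Act) (x y) :
      ACPrDeriv γ (.encap H (.alt x y)) (.alt (.encap H x) (.encap H y))
  | D4 (H : Set Act) (x y) :
      ACPrDeriv γ (.encap H (.seq x y)) (.seq (.encap H x) (.encap H y))
  | RDP (E : GRS Act γ) (X : ℕ) (h : X ∈ E.dom) :
      ACPrDeriv γ (.recur X E) (E.sub (E.rhs X))
  | RSP (E : GRS Act γ) (σ : ℕ → ACPrTerm Act γ)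
      (h : ∀ X ∈ E.dom, ACPrDeriv γ (σ X) (((E.rhs X).toACPr γ).subst σ))
      (X : ℕ) (hX : X ∈ E.dom) :
      ACPrDeriv γ (σ X) (.recur X E)

/-! ### Structural operational semantics of ACPrec -/

mutual
  /-- The transition relation `t —a→ t'` of the structural operational
  semantics of ACPrec. -/
  inductive Step {Act : Type} (γ : Option Act → Option Act → Option Act) :
      ACPrTerm Act γ → Act → ACPrTerm Act γ → Prop
    | altL {x a x'} (y) : Step γ x a x' → Step γ (.alt x y) a x'
    | altR {y a y'} (x) : Step γ y a y' → Step γ (.alt x y) a y'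
    | seqTick {x a} (y) : Tick γ x a → Step γ (.seq x y) a y
    | seqStep {x a x'} (y) : Step γ x a x' → Step γ (.seq x y) a (.seq x' y)
    | parTickL {x a} (y) : Tick γ x a → Step γ (.par x y) a y
    | parTickR {y a} (x) : Tick γ y a → Step γ (.par x y) a x
    | parStepL {x a x'} (y) : Step γ x a x' → Step γ (.par x y) a (.par x' y)
    | parStepR {y a y'} (x) : Step γ y a y' → Step γ (.par x y) a (.par x y')
    | parComm1 {x a y b y' c} : Tick γ x a → Step γ y b y' →
        γ (some a) (some b) = some c → Step γ (.par x y) c y'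
    | parComm2 {x a x' y b c} : Step γ x a x' → Tick γ y b →
        γ (some a) (some b) = some c → Step γ (.par x y) c x'
    | parComm3 {x a x' y b y' c} : Step γ x a x' → Step γ y b y' →
        γ (some a) (some b) = some c → Step γ (.par x y) c (.par x' y')
    | lmTick {x a} (y) : Tick γ x a → Step γ (.lm x y) a y
    | lmStep {x a x'} (y) : Step γ x a x' → Step γ (.lm x y) a (.par x' y)
    | cmComm1 {x a y b y' c} : Tick γ x a → Step γ y b y' →
        γ (some a) (some b) = some c → Step γ (.cm x y) c y'
    | cmComm2 {x a x' y b c} : Step γ x a x' → Tick γ y b →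
        γ (some a) (some b) = some c → Step γ (.cm x y) c x'
    | cmComm3 {x a x' y b y' c} : Step γ x a x' → Step γ y b y' →
        γ (some a) (some b) = some c → Step γ (.cm x y) c (.par x' y')
    | encapStep {x a x'} (H : Set Act) : Step γ x a x' → a ∉ H →
        Step γ (.encap H x) a (.encap H x')
    | recStep {E : GRS Act γ} {X a s} : X ∈ E.dom →
        Step γ (E.sub (E.rhs X)) a s → Step γ (.recur X E) a s

  /-- The successful-termination relation `t —a→ √` of the structural
  operational semantics of ACPrec. -/
  inductive Tick {Act : Type} (γ : Option Act → Option Act → Option Act) :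
      ACPrTerm Act γ → Act → Prop
    | act (a : Act) : Tick γ (.act a) a
    | altL {x a} (y) : Tick γ x a → Tick γ (.alt x y) a
    | altR {y a} (x) : Tick γ y a → Tick γ (.alt x y) a
    | parComm {x a y b c} : Tick γ x a → Tick γ y b →
        γ (some a) (some b) = some c → Tick γ (.par x y) c
    | cmComm {x a y b c} : Tick γ x a → Tick γ y b →
        γ (some a) (some b) = some c → Tick γ (.cm x y) c
    | encapTick {x a} (H : Set Act) : Tick γ x a → a ∉ H →
        Tick γ (.encap H x) a
    | recTick {E : GRS Act γ} {X a} : X ∈ E.dom →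
        Tick γ (E.sub (E.rhs X)) a → Tick γ (.recur X E) a
end

/-- A bisimulation: a binary relation `R` on closed ACPrec terms such that for
all `R`-related `t₁, t₂`, every transition of `t₁` is matched by a transition
of `t₂` with the same action to `R`-related terms and vice versa, and `t₁` can
terminate successfully by performing `a` iff `t₂` can. -/
def IsBisimulation {Act : Type} (γ : Option Act → Option Act → Option Act)
    (R : ACPrTerm Act γ → ACPrTerm Act γ → Prop) : Prop :=
  ∀ ⦃t₁ t₂⦄, R t₁ t₂ →
    t₁.Closed ∧ t₂.Closed ∧
    (∀ a t₁', Step γ t₁ a t₁' → ∃ t₂', Step γ t₂ a t₂' ∧ R t₁' t₂') ∧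
    (∀ a t₂', Step γ t₂ a t₂' → ∃ t₁', Step γ t₁ a t₁' ∧ R t₁' t₂') ∧
    (∀ a, Tick γ t₁ a ↔ Tick γ t₂ a)

/-- Bisimulation equivalence of (closed) ACPrec terms. -/
def Bisim {Act : Type} (γ : Option Act → Option Act → Option Act)
    (t₁ t₂ : ACPrTerm Act γ) : Prop :=
  ∃ R, IsBisimulation γ R ∧ R t₁ t₂


/-- The least congruence with respect to the operators of ACPrec that contains
bisimulation equivalence. -/
inductive BisimClosure {Act : Type} (γ : Option Act → Option Act → Option Act) :
    ACPrTerm Act γ → ACPrTerm Act γ → Prop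
  | base {t s} : Bisim γ t s → BisimClosure γ t s
  | alt {t t' s s'} : BisimClosure γ t t' → BisimClosure γ s s' →
      BisimClosure γ (.alt t s) (.alt t' s')
  | seq {t t' s s'} : BisimClosure γ t t' → BisimClosure γ s s' →
      BisimClosure γ (.seq t s) (.seq t' s')
  | par {t t' s s'} : BisimClosure γ t t' → BisimClosure γ s s' →
      BisimClosure γ (.par t s) (.par t' s')
  | lm {t t' s s'} : BisimClosure γ t t' → BisimClosure γ s s' →
      BisimClosure γ (.lm t s) (.lm t' s')
  | cm {t t' s s'} : BisimClosure γ t t' → BisimClosure γ s s' →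
      BisimClosure γ (.cm t s) (.cm t' s')
  | encap (H : Set Act) {t t'} : BisimClosure γ t t' →
      BisimClosure γ (.encap H t) (.encap H t')

section

variable {Act : Type} {γ : Option Act → Option Act → Option Act}
  {t s t' : ACPrTerm Act γ} {a : Act}

theorem Bisim.symm (h : Bisim γ t s) : Bisim γ s t := by
  obtain ⟨R, hR, hts⟩ := h
  refine ⟨fun x y => R y x, fun x y hxy => ?_, hts⟩
  obtain ⟨hy, hx, hyx, hxy, ht⟩ := hR hxy
  exact ⟨hx, hy, hxy, hyx, fun a => (ht a).symm⟩

theorem Bisim.closed_left (h : Bisim γ t s) : t.Closed := by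
  obtain ⟨R, hR, hts⟩ := h
  exact (hR hts).1

theorem Bisim.exists_step (h : Bisim γ t s) (ht : Step γ t a t') :
    ∃ s', Step γ s a s' ∧ Bisim γ t' s' := by
  obtain ⟨R, hR, hts⟩ := h
  obtain ⟨s', hs, hts'⟩ := (hR hts).2.2.1 a t' ht
  exact ⟨s', hs, R, hR, hts'⟩

theorem Bisim.tick (h : Bisim γ t s) (ht : Tick γ t a) : Tick γ s a := by
  obtain ⟨R, hR, hts⟩ := h
  exact ((hR hts).2.2.2.2 a).1 ht

namespace BisimClosure

theorem symm (h : BisimClosure γ t s) : BisimClosure γ s t := by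
  induction h with
  | base h => exact .base h.symm
  | alt _ _ ih₁ ih₂ => exact .alt ih₁ ih₂
  | seq _ _ ih₁ ih₂ => exact .seq ih₁ ih₂
  | par _ _ ih₁ ih₂ => exact .par ih₁ ih₂
  | lm _ _ ih₁ ih₂ => exact .lm ih₁ ih₂
  | cm _ _ ih₁ ih₂ => exact .cm ih₁ ih₂
  | encap H _ ih => exact .encap H ih

theorem closed_left (h : BisimClosure γ t s) : t.Closed := by
  induction h with
  | base h => exact h.closed_left
  | encap H _ ih => exact ih
  | _ _ _ ih₁ ih₂ => exact ⟨ih₁, ih₂⟩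

theorem tick (h : BisimClosure γ t s) (ht : Tick γ t a) : Tick γ s a := by
  induction h generalizing a with
  | base h => exact h.tick ht
  | alt _ _ ih₁ ih₂ =>
    cases ht with
    | altL _ h => exact .altL _ (ih₁ h)
    | altR _ h => exact .altR _ (ih₂ h)
  | seq => cases ht
  | par _ _ ih₁ ih₂ =>
    cases ht with
    | parComm h₁ h₂ hγ => exact .parComm (ih₁ h₁) (ih₂ h₂) hγ
  | lm => cases ht
  | cm _ _ ih₁ ih₂ =>
    cases ht with
    | cmComm h₁ h₂ hγ => exact .cmComm (ih₁ h₁) (ih₂ h₂) hγ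
  | encap H _ ih =>
    cases ht with
    | encapTick _ h ha => exact .encapTick H (ih h) ha

theorem exists_step (h : BisimClosure γ t s) (ht : Step γ t a t') :
    ∃ s', Step γ s a s' ∧ BisimClosure γ t' s' := by
  induction h generalizing a t' with
  | base h =>
    obtain ⟨s', hs, hts⟩ := h.exists_step ht
    exact ⟨s', hs, .base hts⟩
  | alt _ _ ih₁ ih₂ =>
    cases ht with
    | altL _ h =>
      obtain ⟨x, hx, hr⟩ := ih₁ h
      exact ⟨x, .altL _ hx, hr⟩
    | altR _ h =>
      obtain ⟨x, hx, hr⟩ := ih₂ h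
      exact ⟨x, .altR _ hx, hr⟩
  | seq h₁ h₂ ih₁ _ =>
    cases ht with
    | seqTick _ h => exact ⟨_, .seqTick _ (h₁.tick h), h₂⟩
    | seqStep _ h =>
      obtain ⟨x, hx, hr⟩ := ih₁ h
      exact ⟨_, .seqStep _ hx, .seq hr h₂⟩
  | par h₁ h₂ ih₁ ih₂ =>
    cases ht with
    | parTickL _ h => exact ⟨_, .parTickL _ (h₁.tick h), h₂⟩
    | parTickR _ h => exact ⟨_, .parTickR _ (h₂.tick h), h₁⟩
    | parStepL _ h =>
      obtain ⟨x, hx, hr⟩ := ih₁ h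
      exact ⟨_, .parStepL _ hx, .par hr h₂⟩
    | parStepR _ h =>
      obtain ⟨x, hx, hr⟩ := ih₂ h
      exact ⟨_, .parStepR _ hx, .par h₁ hr⟩
    | parComm1 h h' hγ =>
      obtain ⟨x, hx, hr⟩ := ih₂ h'
      exact ⟨_, .parComm1 (h₁.tick h) hx hγ, hr⟩
    | parComm2 h h' hγ =>
      obtain ⟨x, hx, hr⟩ := ih₁ h
      exact ⟨_, .parComm2 hx (h₂.tick h') hγ, hr⟩
    | parComm3 h h' hγ =>
      obtain ⟨x, hx, hr⟩ := ih₁ h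
      obtain ⟨y, hy, hr'⟩ := ih₂ h'
      exact ⟨_, .parComm3 hx hy hγ, .par hr hr'⟩
  | lm h₁ h₂ ih₁ _ =>
    cases ht with
    | lmTick _ h => exact ⟨_, .lmTick _ (h₁.tick h), h₂⟩
    | lmStep _ h =>
      obtain ⟨x, hx, hr⟩ := ih₁ h
      exact ⟨_, .lmStep _ hx, .par hr h₂⟩
  | cm h₁ h₂ ih₁ ih₂ =>
    cases ht with
    | cmComm1 h h' hγ =>
      obtain ⟨x, hx, hr⟩ := ih₂ h'
      exact ⟨_, .cmComm1 (h₁.tick h) hx hγ, hr⟩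
    | cmComm2 h h' hγ =>
      obtain ⟨x, hx, hr⟩ := ih₁ h
      exact ⟨_, .cmComm2 hx (h₂.tick h') hγ, hr⟩
    | cmComm3 h h' hγ =>
      obtain ⟨x, hx, hr⟩ := ih₁ h
      obtain ⟨y, hy, hr'⟩ := ih₂ h'
      exact ⟨_, .cmComm3 hx hy hγ, .par hr hr'⟩
  | encap H _ ih =>
    cases ht with
    | encapStep _ h ha =>
      obtain ⟨x, hx, hr⟩ := ih h
      exact ⟨_, .encapStep H hx ha, .encap H hr⟩

theorem isBisimulation : IsBisimulation γ (BisimClosure γ) := fun _ _ h =>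
  ⟨h.closed_left, h.symm.closed_left, fun _ _ => h.exists_step,
    fun _ _ hs =>
      let ⟨x, hx, hr⟩ := h.symm.exists_step hs
      ⟨x, hx, hr.symm⟩,
    fun _ => ⟨h.tick, h.symm.tick⟩⟩

theorem bisim (h : BisimClosure γ t s) : Bisim γ t s :=
  ⟨_, isBisimulation, h⟩

end BisimClosure

end

/-- Congruence.
Bisimulation equivalence is a congruence with respect to the operators of
ACPrec. -/
theorem bisim_congruence (Act : Type)
    (γ : Option Act → Option Act → Option Act)
    (hcomm : ∀ a b, γ a b = γ b a)
    (hassoc : ∀ a b c, γ (γ a b) c = γ a (γ b c))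
    (hdelta : ∀ a, γ none a = none)
    (t₁ t₁' t₂ t₂' : ACPrTerm Act γ)
    (hc₁ : t₁.Closed) (hc₁' : t₁'.Closed) (hc₂ : t₂.Closed) (hc₂' : t₂'.Closed)
    (h₁ : Bisim γ t₁ t₁') (h₂ : Bisim γ t₂ t₂') :
    Bisim γ (.alt t₁ t₂) (.alt t₁' t₂') ∧
    Bisim γ (.seq t₁ t₂) (.seq t₁' t₂') ∧
    Bisim γ (.par t₁ t₂) (.par t₁' t₂') ∧
    Bisim γ (.lm t₁ t₂) (.lm t₁' t₂') ∧
    Bisim γ (.cm t₁ t₂) (.cm t₁' t₂') ∧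
    ∀ H : Set Act, Bisim γ (.encap H t₁) (.encap H t₁') :=
  have k₁ := BisimClosure.base h₁
  have k₂ := BisimClosure.base h₂
  ⟨(k₁.alt k₂).bisim, (k₁.seq k₂).bisim, (k₁.par k₂).bisim, (k₁.lm k₂).bisim,
    (k₁.cm k₂).bisim, fun H => (k₁.encap H).bisim⟩

end ACPNote
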